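/- Let D be a split digraph and let k be a positive integer. Then π_k(D) ≤ α_k(D). (Linial's Conjecture holds for split digraphs.) -/

import Mathlib

/-- `p` is a directed path in the digraph with arc relation `A`:
a list of pairwise distinct vertices with consecutive arcs. -/
def IsDipath {V : Type*} (A : V → V → Prop) (p : List V) : Prop :=
  p.Nodup ∧ p.Chain' A

/-- `u` and `v` are adjacent: there is an arc between them in some direction. -/
def DiAdj {V : Type*} (A : V → V → Prop) (u v : V) : Prop := A u v ∨ A v u

/-- A stable set: pairwise non-adjacent vertices. -/
def IsStableSet {V : Type*} (A : V → V → Prop) (S : Set V) : Prop :=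
  ∀ u ∈ S, ∀ v ∈ S, u ≠ v → ¬ DiAdj A u v

/-- A path partition of the digraph: a family of nonempty vertex-disjoint
directed paths covering all vertices. -/
def IsPathPartition {V : Type*} (A : V → V → Prop) (Part : Finset (List V)) : Prop :=
  (∀ p ∈ Part, IsDipath A p ∧ p ≠ []) ∧
  (∀ p ∈ Part, ∀ q ∈ Part, p ≠ q → ∀ v : V, v ∈ p → v ∉ q) ∧
  (∀ v : V, ∃ p ∈ Part, v ∈ p)

/-- The `k`-norm of a path partition: `∑_{P ∈ Part} min (|P|, k)`. -/
def kNorm {V : Type*} (k : ℕ) (Part : Finset (List V)) : ℕ :=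
  ∑ p ∈ Part, min p.length k

/-- `π_k(D)`: the minimum `k`-norm of a path partition. -/
noncomputable def piK {V : Type*} (A : V → V → Prop) (k : ℕ) : ℕ :=
  sInf {n | ∃ Part : Finset (List V), IsPathPartition A Part ∧ kNorm k Part = n}

/-- A `k`-partial coloring: `k` pairwise disjoint stable color classes
(possibly empty). -/
def IsKPartialColoring {V : Type*} (A : V → V → Prop) (k : ℕ) (C : Fin k → Finset V) : Prop :=
  (∀ i, IsStableSet A ((C i : Finset V) : Set V)) ∧
  ∀ i j, i ≠ j → Disjoint (C i) (C j)

/-- `α_k(D)`: the maximum weight (total size) of a `k`-partial coloring. -/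
noncomputable def alphaK {V : Type*} (A : V → V → Prop) (k : ℕ) : ℕ :=
  sSup {n | ∃ C : Fin k → Finset V, IsKPartialColoring A k C ∧ ∑ i, (C i).card = n}

/-- `{X, Y}` witnesses that the digraph is a spine digraph: `X` and `Y`
partition the vertex set, the subdigraph induced by `X` is traceable
(has a Hamiltonian directed path), and `Y` is stable. -/
def IsSpinePartition {V : Type*} (A : V → V → Prop) (X Y : Finset V) : Prop :=
  (∀ v : V, v ∈ X ↔ v ∉ Y) ∧
  (∃ p : List V, IsDipath A p ∧ ∀ v : V, v ∈ p ↔ v ∈ X) ∧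
  IsStableSet A (Y : Set V)

/-- A spine digraph `D[X,Y]` is `k`-loose if `|X| < k` or some `k`-subset `S` of
`X` is such that no `y ∈ Y` is adjacent to every vertex of `S`. -/
def IsKLoose {V : Type*} (A : V → V → Prop) (k : ℕ) (X Y : Finset V) : Prop :=
  X.card < k ∨ ∃ S ⊆ X, S.card = k ∧ ∀ y ∈ Y, ∃ x ∈ S, ¬ DiAdj A y x

/-- A Hamiltonian path `p` of `D[X]` is zigzag-free in `D` if no `y ∈ Y` has an
arc into the first vertex, no arc from the last vertex into `y`, and there is no
`i` with arcs `(p_i, y)` and `(y, p_{i+1})`. -/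
def ZigzagFree {V : Type*} (A : V → V → Prop) (Y : Finset V) (p : List V) : Prop :=
  ∀ y ∈ Y,
    (∀ h : p ≠ [], ¬ A y (p.head h)) ∧
    (∀ h : p ≠ [], ¬ A (p.getLast h) y) ∧
    (∀ i : ℕ, ∀ hi : i + 1 < p.length,
      ¬ (A (p.get ⟨i, Nat.lt_of_succ_lt hi⟩) y ∧ A y (p.get ⟨i + 1, hi⟩)))

section Bounds

variable {V : Type*} [Fintype V] {A : V → V → Prop} {k : ℕ}

/-- A partial coloring given by a coloring function on a set `W` bounds `α_k` from below. -/
theorem card_le_alphaK (W : Finset V) (e : V → Fin k)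
    (he : ∀ u ∈ W, ∀ v ∈ W, u ≠ v → e u = e v → ¬ DiAdj A u v) :
    W.card ≤ alphaK A k := by
  classical
  refine le_csSup ⟨k * Fintype.card V, ?_⟩ ⟨fun i => W.filter (e · = i), ⟨?_, ?_⟩, ?_⟩
  · rintro n ⟨C, -, rfl⟩
    calc ∑ i, (C i).card ≤ ∑ _i : Fin k, Fintype.card V :=
          Finset.sum_le_sum fun i _ => Finset.card_le_univ _
      _ = k * Fintype.card V := by simp
  · intro i u hu v hv huv
    simp only [Finset.coe_filter, Set.mem_ofPred_eq] at hu hv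
    exact he u hu.1 v hv.1 huv (hu.2.trans hv.2.symm)
  · intro i j hij
    rw [Finset.disjoint_left]
    intro a ha hb
    simp only [Finset.mem_filter] at ha hb
    exact hij (ha.2.symm.trans hb.2)
  · exact (Finset.card_eq_sum_card_fiberwise fun _ _ => Finset.mem_univ _).symm

variable [DecidableEq V]

/-- A stable set together with fewer than `k` further vertices can be colored with `k` colors. -/
theorem card_union_le_alphaK_of_card_lt {S Y : Finset V} (hdisj : Disjoint S Y)
    (hY : IsStableSet A (Y : Set V)) (hS : S.card < k) :
    S.card + Y.card ≤ alphaK A k := by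
  rw [← Finset.card_union_of_disjoint hdisj]
  have h0 : 0 < k := by omega
  refine card_le_alphaK (S ∪ Y)
    (fun v => if h : v ∈ S then ⟨S.equivFin ⟨v, h⟩, (S.equivFin ⟨v, h⟩).2.trans hS⟩
      else ⟨k - 1, by omega⟩) ?_
  intro u hu v hv huv heq
  have key : ∀ w (h : w ∈ S), (S.equivFin ⟨w, h⟩ : ℕ) < k - 1 := fun w h => by
    have := (S.equivFin ⟨w, h⟩).2
    omega
  by_cases h1 : u ∈ S <;> by_cases h2 : v ∈ S
  · simp only [h1, h2, dif_pos, Fin.mk.injEq] at heq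
    have := S.equivFin.injective (Fin.ext heq)
    simp only [Subtype.mk.injEq] at this
    exact absurd this huv
  · simp only [h1, h2, dif_pos, dif_neg, not_false_iff, Fin.mk.injEq] at heq
    have := key u h1
    omega
  · simp only [h1, h2, dif_pos, dif_neg, not_false_iff, Fin.mk.injEq] at heq
    have := key v h2
    omega
  · simp only [Finset.mem_union, h1, h2, false_or] at hu hv
    exact hY u hu v hv huv

/-- If every vertex of a stable set `Y` has a non-neighbor in the `k`-set `S`, then
`S ∪ Y` can be colored with `k` colors. -/
theorem card_union_le_alphaK_of_loose {S Y : Finset V} (hdisj : Disjoint S Y)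
    (hY : IsStableSet A (Y : Set V)) (hS : S.card = k)
    (hloose : ∀ y ∈ Y, ∃ x ∈ S, ¬ DiAdj A y x) :
    k + Y.card ≤ alphaK A k := by
  rw [← hS, ← Finset.card_union_of_disjoint hdisj, hS]
  choose! g hgS hg using hloose
  have hr : ∀ v ∈ S ∪ Y, (if v ∈ S then v else g v) ∈ S := by
    intro v hv
    split_ifs with h
    · exact h
    · exact hgS v ((Finset.mem_union.1 hv).resolve_left h)
  have hadj : ∀ u v, DiAdj A u v → DiAdj A v u := fun u v h => Or.symm h
  rcases Nat.eq_zero_or_pos k with rfl | h0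
  · have hS0 : S = ∅ := Finset.card_eq_zero.1 hS
    have : S ∪ Y = ∅ := Finset.eq_empty_of_forall_notMem fun v hv => by
      have := hr v hv
      simp [hS0] at this
    simp [this]
  refine card_le_alphaK (S ∪ Y)
    (fun v => if h : (if v ∈ S then v else g v) ∈ S then
      Fin.cast hS (S.equivFin ⟨_, h⟩) else ⟨0, h0⟩) ?_
  intro u hu v hv huv heq
  simp only [hr u hu, hr v hv, dif_pos] at heq
  have heq := S.equivFin.injective (Fin.cast_injective hS heq)
  simp only [Subtype.mk.injEq] at heq
  by_cases h1 : u ∈ S <;> by_cases h2 : v ∈ S <;>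
    simp only [h1, h2, if_true, if_false, Finset.mem_union, false_or] at heq hu hv
  · exact absurd heq huv
  · exact fun h => hg v hv (heq ▸ hadj _ _ h)
  · exact fun h => hg u hu (heq ▸ h)
  · exact hY u hu v hv huv

/-- Two disjoint paths, possibly empty, extended by singletons bound `π_k` from above. -/
theorem piK_le_of_two_paths {U W : List V} (hnd : (U ++ W).Nodup)
    (hU : U.IsChain A) (hW : W.IsChain A) (hk : 0 < k) :
    piK A k + (U.length + W.length) ≤ min U.length k + min W.length k + Fintype.card V := by
  set R : Finset V := (U ++ W).toFinsetᶜ with hR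
  set Part : Finset (List V) := ({U, W} ∪ R.image fun v => [v]).erase [] with hPart
  have hmem : ∀ p, p ∈ Part ↔ p ≠ [] ∧ (p = U ∨ p = W ∨ ∃ v, v ∉ U ∧ v ∉ W ∧ p = [v]) := by
    intro p
    simp [hPart, hR, eq_comm, and_assoc]
  obtain ⟨hUn, hWn, hdis⟩ := List.nodup_append.1 hnd
  have hpp : IsPathPartition A Part := by
    refine ⟨?_, ?_, ?_⟩
    · intro p hp
      obtain ⟨h0, rfl | rfl | ⟨v, -, -, rfl⟩⟩ := (hmem p).1 hp
      · exact ⟨⟨hUn, hU⟩, h0⟩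
      · exact ⟨⟨hWn, hW⟩, h0⟩
      · exact ⟨⟨List.nodup_singleton v, List.isChain_singleton v⟩, h0⟩
    · intro p hp q hq hpq v hvp hvq
      obtain ⟨-, rfl | rfl | ⟨a, ha, ha', rfl⟩⟩ := (hmem p).1 hp <;>
        obtain ⟨-, rfl | rfl | ⟨b, hb, hb', rfl⟩⟩ := (hmem q).1 hq <;>
        grind
    · intro v
      by_cases h1 : v ∈ U
      · exact ⟨U, (hmem U).2 ⟨List.ne_nil_of_mem h1, Or.inl rfl⟩, h1⟩
      by_cases h2 : v ∈ W
      · exact ⟨W, (hmem W).2 ⟨List.ne_nil_of_mem h2, Or.inr (Or.inl rfl)⟩, h2⟩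
      · exact ⟨[v], (hmem _).2 ⟨by simp, Or.inr (Or.inr ⟨v, h1, h2, rfl⟩)⟩, by simp⟩
  have h1 : piK A k ≤ kNorm k Part := Nat.sInf_le ⟨Part, hpp, rfl⟩
  have h2 : kNorm k Part ≤ min U.length k + min W.length k + R.card := by
    calc kNorm k Part ≤ ∑ p ∈ {U, W} ∪ R.image (fun v => [v]), min p.length k :=
          Finset.sum_le_sum_of_subset (Finset.erase_subset _ _)
      _ ≤ ∑ p ∈ {U, W}, min p.length k + ∑ p ∈ R.image (fun v => [v]), min p.length k := by
          rw [← Finset.sum_union_inter]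
          exact Nat.le_add_right _ _
      _ ≤ _ := by
          gcongr
          · by_cases h : U = W
            · simp [h]
            · rw [Finset.sum_pair h]
          · rw [Finset.sum_image fun a _ b _ h => by simpa using h]
            simp [Nat.min_eq_left hk]
  have h3 : R.card + (U.length + W.length) = Fintype.card V := by
    rw [← List.length_append, ← List.toFinset_card_of_nodup hnd, hR]
    exact Finset.card_compl_add_card _
  omega

end Bounds

section Paths

variable {V : Type*} {A : V → V → Prop}

/-- A vertex adjacent to all vertices of a path can be inserted after the first vertex. -/
theorem exists_perm_isChain_cons {v : V} (p : List V) :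
    ∀ a, (a :: p).IsChain A → A a v → (∀ x ∈ p, A v x ∨ A x v) →
      ∃ q : List V, q.Perm (v :: p) ∧ (a :: q).IsChain A := by
  induction p with
  | nil => exact fun a _ ha _ => ⟨[v], List.Perm.refl _, by simpa using ha⟩
  | cons b p ih =>
    intro a hc ha hadj
    rw [List.isChain_cons_cons] at hc
    by_cases hb : A v b
    · exact ⟨v :: b :: p, List.Perm.refl _, by simp [List.isChain_cons_cons, ha, hb, hc.2]⟩
    · obtain ⟨q, hq, hqc⟩ := ih b hc.2 ((hadj b (by simp)).resolve_left hb)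
        fun x hx => hadj x (by simp [hx])
      exact ⟨b :: q, (hq.cons b).trans (List.Perm.swap v b p),
        List.isChain_cons_cons.2 ⟨hc.1, hqc⟩⟩

/-- Rédei's theorem: a semi-complete digraph has a Hamiltonian path. -/
theorem exists_hamiltonian_path [DecidableEq V] (X : Finset V)
    (hsemi : ∀ u ∈ X, ∀ v ∈ X, u ≠ v → A u v ∨ A v u) :
    ∃ p : List V, p.Nodup ∧ p.IsChain A ∧ ∀ v, v ∈ p ↔ v ∈ X := by
  induction X using Finset.induction_on with
  | empty => exact ⟨[], by simp⟩
  | insert v X hv ih =>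
    obtain ⟨p, hnd, hc, hmem⟩ := ih fun a ha b hb =>
      hsemi a (Finset.mem_insert_of_mem ha) b (Finset.mem_insert_of_mem hb)
    have hadj : ∀ x ∈ p, A v x ∨ A x v := fun x hx =>
      hsemi v (Finset.mem_insert_self _ _) x (Finset.mem_insert_of_mem ((hmem x).1 hx))
        fun h => hv (h ▸ (hmem x).1 hx)
    obtain ⟨q, hq, hqc⟩ : ∃ q : List V, q.Perm (v :: p) ∧ q.IsChain A := by
      cases p with
      | nil => exact ⟨[v], List.Perm.refl _, List.isChain_singleton v⟩
      | cons a p =>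
        by_cases ha : A v a
        · exact ⟨v :: a :: p, List.Perm.refl _, List.isChain_cons_cons.2 ⟨ha, hc⟩⟩
        · obtain ⟨q, hq, hqc⟩ := exists_perm_isChain_cons p a hc
            ((hadj a (by simp)).resolve_left ha) fun x hx => hadj x (by simp [hx])
          exact ⟨a :: q, (hq.cons a).trans (List.Perm.swap v a p), hqc⟩
    refine ⟨q, hq.nodup_iff.2 (List.nodup_cons.2 ⟨fun h => hv ((hmem v).1 h), hnd⟩), hqc, ?_⟩
    intro x
    rw [hq.mem_iff]
    simp [hmem]

/-- No vertex of `Y` can be inserted into the path `p`. -/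
structure NoInsertion (A : V → V → Prop) (Y : Finset V) (p : List V) : Prop where
  head : ∀ y ∈ Y, ∀ b r, p = b :: r → ¬ A y b
  last : ∀ y ∈ Y, ∀ l b, p = l ++ [b] → ¬ A b y
  mid : ∀ y ∈ Y, ∀ l a b r, p = l ++ a :: b :: r → A a y → ¬ A y b

/-- If some vertex of `Y` can be inserted into a path, there is a path with one more vertex. -/
theorem exists_insertion {Y : Finset V} {p : List V} (hnd : p.Nodup) (hc : p.IsChain A)
    (hpY : ∀ v ∈ p, v ∉ Y) (h : ¬ NoInsertion A Y p) :
    ∃ q : List V, q.Nodup ∧ q.IsChain A ∧ q.length = p.length + 1 := by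
  suffices ∃ y ∈ Y, ∃ q : List V, q.Perm (y :: p) ∧ q.IsChain A by
    obtain ⟨y, hy, q, hq, hqc⟩ := this
    exact ⟨q, hq.nodup_iff.2 (List.nodup_cons.2 ⟨fun h => hpY y h hy, hnd⟩), hqc,
      by simp [hq.length_eq]⟩
  by_contra hcon
  push Not at hcon
  refine h ⟨?_, ?_, ?_⟩
  · rintro y hy b r rfl hyb
    exact hcon y hy _ (List.Perm.refl _) (List.isChain_cons_cons.2 ⟨hyb, hc⟩)
  · rintro y hy l b rfl hby
    refine hcon y hy (l ++ [b] ++ [y]) (List.perm_append_singleton _ _) ?_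
    rw [List.isChain_append]
    exact ⟨hc, List.isChain_singleton y, by simpa using hby⟩
  · rintro y hy l a b r rfl hay hyb
    refine hcon y hy (l ++ a :: y :: b :: r) ?_ ?_
    · have := List.perm_middle (a := y) (l₁ := l ++ [a]) (l₂ := b :: r)
      simpa using this
    · rw [List.isChain_append_cons_cons] at hc ⊢
      exact ⟨hc.1, hay, List.isChain_cons_cons.2 ⟨hyb, hc.2.2⟩⟩

/-- A vertex adjacent to a whole final segment of a path in which it cannot be inserted
dominates this segment. -/
theorem NoInsertion.arc_of_adj_suffix {Y : Finset V} {p : List V} (h : NoInsertion A Y p)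
    {y : V} (hy : y ∈ Y) (r : List V) :
    ∀ l b, p = l ++ b :: r → (∀ x ∈ b :: r, DiAdj A y x) → A y b := by
  induction r with
  | nil => exact fun l b hp hadj => (hadj b (by simp)).resolve_right (h.last y hy l b hp)
  | cons b' r ih =>
    intro l b hp hadj
    have hb' : A y b' := ih (l ++ [b]) b' (by simp [hp]) fun x hx => hadj x (by simp [hx])
    exact (hadj b (by simp)).resolve_right fun hb => h.mid y hy l b b' r hp hb hb'

/-- Splitting a list at the first element satisfying a predicate. -/
theorem exists_first_split {P : V → Prop} (q : List V) {b : V} {r : List V} (hb : P b) :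
    ∃ m t r', q ++ b :: r = m ++ t :: r' ∧ P t ∧ (∀ x ∈ m, ¬ P x) ∧ r.length ≤ r'.length := by
  induction q with
  | nil => exact ⟨[], b, r, rfl, hb, by simp, le_rfl⟩
  | cons a q ih =>
    by_cases ha : P a
    · exact ⟨[], a, q ++ b :: r, rfl, ha, by simp, by simp; omega⟩
    · obtain ⟨m, t, r', h1, h2, h3, h4⟩ := ih
      exact ⟨a :: m, t, r', by simp [h1], h2, by simpa [ha] using h3, h4⟩

/-- Two disjoint paths `U` and `W` covering the initial segment `d` of the path `d ++ q` and
some vertices of `Y`, where `W` can be continued by `q`, and `U` can be continued by any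
vertex of `Y` that is dominated by the set `S ⊆ d`. -/
structure PathPair (A : V → V → Prop) (Y : Finset V) (d q U W : List V) (S : Finset V) :
    Prop where
  subset : ∀ s ∈ S, s ∈ d
  dominated : ∀ y ∈ Y, (∀ s ∈ S, DiAdj A y s) → ∀ s ∈ S, A s y
  front : ∀ y ∈ Y, (∀ s ∈ S, A s y) → ∀ t ∈ q.head?, ¬ A y t
  nodup : (U ++ W).Nodup
  mem : ∀ v ∈ U ++ W, v ∈ d ∨ v ∈ Y
  fresh : ∀ z ∈ Y, z ∈ U ++ W → ∃ s ∈ S, ¬ A s z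
  left : ∀ y ∈ Y, (∀ s ∈ S, A s y) → (U ++ [y]).IsChain A
  right : (W ++ q).IsChain A
  length_add : U.length + W.length = d.length + S.card
  le_left : S.card ≤ U.length
  le_right : S.card ≤ W.length

variable [DecidableEq V] {Y : Finset V} {p : List V}

/-- One step of the construction: the roles of the two paths are exchanged. -/
theorem PathPair.step (hno : NoInsertion A Y p) (hnd : p.Nodup) (hpY : ∀ v ∈ p, v ∉ Y)
    {d m r U W : List V} {S : Finset V} {x t z : V}
    (h : PathPair A Y d (m ++ x :: t :: r) U W S) (hp : p = d ++ (m ++ x :: t :: r))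
    (hz : z ∈ Y) (hSz : ∀ s ∈ S, A s z) (hzt : A z t)
    (hx : ∀ y ∈ Y, (∀ s ∈ S, A s y) → ¬ A y x) :
    PathPair A Y (d ++ (m ++ [x])) (t :: r) (W ++ (m ++ [x])) (U ++ [z]) (insert x S) := by
  have hp' : p = (d ++ m) ++ x :: t :: r := by simp [hp]
  have hxS : x ∉ S := fun hxS => by
    have := h.subset x hxS
    rw [hp] at hnd
    grind
  have hcard : (insert x S).card = S.card + 1 := Finset.card_insert_of_notMem hxS
  have hzU : z ∉ U ++ W := fun hzU => by
    obtain ⟨s, hs, hsz⟩ := h.fresh z hz hzU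
    exact hsz (hSz s hs)
  have hmx : (W ++ (m ++ [x])).IsChain A := by
    have := h.right
    rw [show W ++ (m ++ x :: t :: r) = (W ++ (m ++ [x])) ++ t :: r by simp] at this
    exact this.left_of_append
  have htr : (t :: r).IsChain A := by
    have := h.right
    rw [show W ++ (m ++ x :: t :: r) = (W ++ (m ++ [x])) ++ t :: r by simp] at this
    exact this.right_of_append
  refine ⟨?_, ?_, ?_, ?_, ?_, ?_, ?_, ?_, ?_, ?_, ?_⟩
  · intro s hs
    rcases Finset.mem_insert.1 hs with rfl | hs
    · simp
    · exact List.mem_append_left _ (h.subset s hs)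
  · intro y hy hadj
    have hS := h.dominated y hy fun s hs => hadj s (Finset.mem_insert_of_mem hs)
    intro s hs
    rcases Finset.mem_insert.1 hs with rfl | hs
    · exact (hadj s (Finset.mem_insert_self _ _)).resolve_left (hx y hy hS)
    · exact hS s hs
  · intro y hy hS t' ht'
    obtain rfl : t = t' := by simpa using ht'
    exact hno.mid y hy _ x t r hp' (hS x (Finset.mem_insert_self _ _))
  · have hmxp : ∀ v ∈ m ++ [x], v ∉ U ++ W := by
      intro v hv hv'
      have hvp : v ∈ p := by rw [hp]; grind
      rcases h.mem v hv' with hd | hY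
      · rw [hp] at hnd
        grind
      · exact hpY v hvp hY
    have hmxz : z ∉ m ++ [x] := fun hv => hpY z (by rw [hp]; grind) hz
    have hmxn : (m ++ [x]).Nodup := by
      rw [hp, show m ++ x :: t :: r = (m ++ [x]) ++ t :: r by simp] at hnd
      exact (List.nodup_append.1 (List.nodup_append.1 hnd).2.1).1
    have hUW : (z :: ((m ++ [x]) ++ (U ++ W))).Nodup := by
      refine List.nodup_cons.2 ⟨by rw [List.mem_append]; tauto, ?_⟩
      refine List.nodup_append.2 ⟨hmxn, h.nodup, ?_⟩
      rintro a ha b hb rfl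
      exact hmxp a ha hb
    refine (List.Perm.nodup_iff ?_).2 hUW
    rw [List.perm_iff_count]
    intro a
    simp only [List.count_append, List.count_cons, List.count_nil]
    omega
  · intro v hv
    have : v ∈ U ++ W ∨ v ∈ m ++ [x] ∨ v = z := by grind
    rcases this with hv | hv | rfl
    · rcases h.mem v hv with hv | hv
      · exact Or.inl (List.mem_append_left _ hv)
      · exact Or.inr hv
    · exact Or.inl (List.mem_append_right _ hv)
    · exact Or.inr hz
  · intro y hy hyU
    have : y ∈ U ++ W ∨ y ∈ m ++ [x] ∨ y = z := by grind
    rcases this with hv | hv | rfl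
    · obtain ⟨s, hs, hsy⟩ := h.fresh y hy hv
      exact ⟨s, Finset.mem_insert_of_mem hs, hsy⟩
    · exact absurd hy (hpY y (by rw [hp]; grind))
    · exact ⟨x, Finset.mem_insert_self _ _, fun hxy => hno.mid y hy _ x t r hp' hxy hzt⟩
  · intro y _ hS
    rw [List.isChain_append]
    refine ⟨hmx, List.isChain_singleton y, ?_⟩
    have := hS x (Finset.mem_insert_self _ _)
    simpa using this
  · rw [List.isChain_append]
    exact ⟨h.left z hz hSz, htr, by simpa using hzt⟩
  · have := h.length_add
    simp only [List.length_append, List.length_singleton, hcard] at *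
    omega
  · have := h.le_right
    simp only [List.length_append, List.length_singleton, hcard] at *
    omega
  · have := h.le_left
    simp only [List.length_append, List.length_singleton, hcard] at *
    omega

/-- The construction can be continued up to any `i ≤ k` provided every `k`-set of vertices of
the path has a common neighbor in `Y`. -/
theorem exists_pathPair (hno : NoInsertion A Y p) (hnd : p.Nodup) (hc : p.IsChain A)
    (hpY : ∀ v ∈ p, v ∉ Y) {k : ℕ} (hk : k ≤ p.length)
    (htight : ∀ S : Finset V, (∀ s ∈ S, s ∈ p) → S.card = k → ∃ y ∈ Y, ∀ x ∈ S, DiAdj A y x)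
    {i : ℕ} (hi : i ≤ k) :
    ∃ d q U W S, p = d ++ q ∧ k ≤ q.length + i ∧ S.card = i ∧ PathPair A Y d q U W S := by
  induction i with
  | zero =>
    refine ⟨[], p, [], [], ∅, rfl, by simpa using hk, rfl, ?_⟩
    refine ⟨by simp, by simp, ?_, by simp, by simp, by simp, by simp, by simpa using hc,
      by simp, by simp, by simp⟩
    intro y hy _ t ht
    cases p with
    | nil => simp at ht
    | cons a p =>
      obtain rfl : a = t := by simpa using ht
      exact hno.head y hy a p rfl
  | succ i ih =>
    obtain ⟨d, q, U, W, S, hp, hq, hS, h⟩ := ih (by omega)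
    obtain ⟨q₁, b, r, rfl, hr⟩ : ∃ q₁ b r, q = q₁ ++ b :: r ∧ r.length + 1 = k - i := by
      have hlt : q.length - (k - i) < q.length := by omega
      refine ⟨q.take (q.length - (k - i)), q[q.length - (k - i)],
        q.drop (q.length - (k - i) + 1), ?_, ?_⟩
      · rw [List.getElem_cons_drop, List.take_append_drop]
      · rw [List.length_drop]
        omega
    have hsuf : (b :: r).Nodup := by
      rw [hp] at hnd
      exact (List.nodup_append.1 (List.nodup_append.1 hnd).2.1).2.1
    have hdisj : Disjoint S (b :: r).toFinset := by
      rw [Finset.disjoint_left]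
      intro s hs hs'
      have h1 := h.subset s hs
      have h2 := List.mem_toFinset.1 hs'
      rw [hp] at hnd
      exact (List.nodup_append.1 hnd).2.2 s h1 s (List.mem_append_right _ h2) rfl
    obtain ⟨y, hy, hadj⟩ := htight (S ∪ (b :: r).toFinset)
      (by
        intro s hs
        rw [hp]
        rcases Finset.mem_union.1 hs with hs | hs
        · exact List.mem_append_left _ (h.subset s hs)
        · exact List.mem_append_right _ (List.mem_append_right _ (List.mem_toFinset.1 hs)))
      (by
        rw [Finset.card_union_of_disjoint hdisj, List.toFinset_card_of_nodup hsuf, hS,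
          List.length_cons]
        omega)
    have hyS := h.dominated y hy fun s hs => hadj s (Finset.mem_union_left _ hs)
    have hyb : A y b := hno.arc_of_adj_suffix hy r (d ++ q₁) b (by simp [hp])
      fun x hx => hadj x (Finset.mem_union_right _ (List.mem_toFinset.2 hx))
    obtain ⟨m, t, r', hsplit, ⟨z, hz, hSz, hzt⟩, hm, hlen⟩ :=
      exists_first_split (P := fun t => ∃ y ∈ Y, (∀ s ∈ S, A s y) ∧ A y t) q₁ (r := r)
        ⟨y, hy, hyS, hyb⟩
    rw [hsplit] at hp h
    rcases List.eq_nil_or_concat' m with rfl | ⟨m, x, rfl⟩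
    · exact absurd hzt (h.front z hz hSz t (by simp))
    rw [show m ++ [x] ++ t :: r' = m ++ x :: t :: r' by simp] at hp h
    have hx : ∀ y ∈ Y, (∀ s ∈ S, A s y) → ¬ A y x := fun y hy hS hyx =>
      hm x (by simp) ⟨y, hy, hS, hyx⟩
    have hstep := h.step hno hnd hpY hp hz hSz hzt hx
    refine ⟨_, _, _, _, _, by simp [hp], ?_, ?_, hstep⟩
    · simp only [List.length_cons]
      omega
    · rw [Finset.card_insert_of_notMem, hS]
      intro hxS
      have := h.subset x hxS
      rw [hp] at hnd
      grind

/-- If no vertex of `Y` can be inserted into the path `p`, but every `k`-set of vertices of `p`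
has a common neighbor in `Y`, then there are two disjoint paths with at least `k` vertices each
and `p.length + k + 1` vertices in total. -/
theorem exists_two_paths (hno : NoInsertion A Y p) (hnd : p.Nodup) (hc : p.IsChain A)
    (hpY : ∀ v ∈ p, v ∉ Y) {k : ℕ} (hk : k ≤ p.length)
    (htight : ∀ S : Finset V, (∀ s ∈ S, s ∈ p) → S.card = k → ∃ y ∈ Y, ∀ x ∈ S, DiAdj A y x) :
    ∃ U W : List V, (U ++ W).Nodup ∧ U.IsChain A ∧ W.IsChain A ∧
      U.length + W.length = p.length + k + 1 := by
  obtain ⟨d, q, U, W, S, hp, -, hS, h⟩ := exists_pathPair hno hnd hc hpY hk htight le_rfl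
  obtain ⟨y, hy, hadj⟩ := htight S (fun s hs => hp ▸ List.mem_append_left _ (h.subset s hs)) hS
  have hyS := h.dominated y hy hadj
  refine ⟨U ++ [y], W ++ q, ?_, h.left y hy hyS, h.right, ?_⟩
  · have hyU : y ∉ U ++ W := fun hyU => by
      obtain ⟨s, hs, hsy⟩ := h.fresh y hy hyU
      exact hsy (hyS s hs)
    have hyq : y ∉ q := fun hyq => hpY y (hp ▸ List.mem_append_right _ hyq) hy
    have hUW : (y :: (q ++ (U ++ W))).Nodup := by
      refine List.nodup_cons.2 ⟨by rw [List.mem_append]; tauto, ?_⟩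
      rw [hp] at hnd
      have hnd' := List.nodup_append.1 hnd
      refine List.nodup_append.2 ⟨hnd'.2.1, h.nodup, ?_⟩
      rintro a ha b hb rfl
      rcases h.mem a hb with hd | hY
      · exact hnd'.2.2 a hd a ha rfl
      · exact hpY a (hp ▸ List.mem_append_right _ ha) hY
    refine (List.Perm.nodup_iff ?_).2 hUW
    rw [List.perm_iff_count]
    intro a
    simp only [List.count_append, List.count_cons, List.count_nil]
    omega
  · have := h.length_add
    simp only [hp, List.length_append, List.length_singleton] at *
    omega

end Paths

/-- Linial's Conjecture holds for split digraphs: the vertex set is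
partitioned into `X` inducing a semi-complete digraph and a stable set `Y`, and
then `π_k(D) ≤ α_k(D)` for every positive integer `k`. -/
theorem split_linial {V : Type*} [Fintype V] [DecidableEq V]
    (A : V → V → Prop) (hloopless : Irreflexive A)
    (X Y : Finset V)
    (hpart : ∀ v : V, v ∈ X ↔ v ∉ Y)
    (hsemi : ∀ u ∈ X, ∀ v ∈ X, u ≠ v → A u v ∨ A v u)
    (hstable : IsStableSet A (Y : Set V))
    (k : ℕ) (hk : 0 < k) :
    piK A k ≤ alphaK A k := by
  have hdisj : Disjoint X Y := Finset.disjoint_left.2 fun v hv => (hpart v).1 hv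
  have hcard : Fintype.card V = X.card + Y.card := by
    rw [← Finset.card_union_of_disjoint hdisj, ← Finset.card_univ]
    congr 1
    ext v
    have := hpart v
    simp only [Finset.mem_univ, Finset.mem_union, true_iff]
    tauto
  by_cases hX : X.card < k
  · have h1 := card_union_le_alphaK_of_card_lt hdisj hstable hX
    have h2 := piK_le_of_two_paths (A := A) (U := []) (W := []) List.nodup_nil
      List.isChain_nil List.isChain_nil hk
    simp only [List.length_nil] at h2
    omega
  push Not at hX
  obtain ⟨p, hnd, hc, hmem⟩ := exists_hamiltonian_path X hsemi
  have hlen : p.length = X.card := by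
    rw [← List.toFinset_card_of_nodup hnd]
    congr 1
    ext v
    simp [hmem]
  have hpY : ∀ v ∈ p, v ∉ Y := fun v hv => (hpart v).1 ((hmem v).1 hv)
  by_cases hloose : ∃ S ⊆ X, S.card = k ∧ ∀ y ∈ Y, ∃ x ∈ S, ¬ DiAdj A y x
  · obtain ⟨S, hSX, hS, hSY⟩ := hloose
    have h1 := card_union_le_alphaK_of_loose
      (Finset.disjoint_of_subset_left hSX hdisj) hstable hS hSY
    have h2 := piK_le_of_two_paths (A := A) (U := p) (W := []) (by simpa using hnd) hc
      List.isChain_nil hk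
    simp only [List.length_nil] at h2
    omega
  push Not at hloose
  obtain ⟨S, hSX, hS⟩ := Finset.exists_subset_card_eq (show k - 1 ≤ X.card by omega)
  have hα := card_union_le_alphaK_of_card_lt (A := A) (k := k)
    (Finset.disjoint_of_subset_left hSX hdisj) hstable (by omega)
  by_cases hno : NoInsertion A Y p
  · obtain ⟨U, W, hUW, hU, hW, hl⟩ := exists_two_paths hno hnd hc hpY (k := k) (by omega)
      fun S hSp => hloose S fun s hs => (hmem s).1 (hSp s hs)
    have h2 := piK_le_of_two_paths hUW hU hW hk
    omega
  · obtain ⟨q, hq, hqc, hql⟩ := exists_insertion hnd hc hpY hno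
    have h2 := piK_le_of_two_paths (A := A) (U := q) (W := []) (by simpa using hq) hqc
      List.isChain_nil hk
    simp only [List.length_nil] at h2
    omega
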